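/- Let A be a commutative integral domain, let r ≥ 1 and s ≥ 0 be integers, n = 2r + s, and let X_1, …, X_{r+s} ∈ A be nonzero elements such that X_i − X_j is a unit of A whenever i ≠ j. Let Q_1(X) = ∏_{i=1}^r (X − X_i), Q_2(X) = ∏_{j=r+1}^{r+s} (X − X_j) (with Q_2 = 1 if s = 0), S_i(X) = Q_1(X)/(X − X_i) and T_j(X) = Q_2(X)/(X − X_j). Then for each ℓ ∈ {0, …, n−1} there exist α_{iℓ}, β_{iℓ} ∈ A (1 ≤ i ≤ r) and γ_{jℓ} ∈ A (r+1 ≤ j ≤ r+s), with all α_{iℓ} and γ_{jℓ} nonzero, such that the polynomial X^{2ℓ} − ∑_{i=1}^r ( α_{iℓ}² S_i(X)⁴ Q_2(X)² + β_{iℓ}² Q_1(X)² S_i(X)² Q_2(X)² ) − ∑_{j=r+1}^{r+s} γ_{jℓ}² Q_1(X)⁴ T_j(X)² lies in the ideal 2·A[X] and has degree at most 2n − 1. -/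

import Mathlib

open Polynomial Finset

theorem two_dvd_sq_sum_sub_sum_sq {R ι : Type*} [CommRing R] (t : Finset ι) (f : ι → R) :
    (2 : R) ∣ (∑ i ∈ t, f i) ^ 2 - ∑ i ∈ t, f i ^ 2 := by
  classical
  induction t using Finset.induction_on with
  | empty => simp
  | insert a t ha ih =>
    rw [sum_insert ha, sum_insert ha]
    obtain ⟨c, hc⟩ := ih
    exact ⟨c + f a * ∑ i ∈ t, f i, by linear_combination hc⟩

theorem two_dvd_sq_sub_sum_sq {R ι κ : Type*} [CommRing R] [Fintype ι] [Fintype κ]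
    (a b : ι → R) (c : κ → R) :
    (2 : R) ∣ (∑ i, (a i + b i) + ∑ j, c j) ^ 2 - ∑ i, (a i ^ 2 + b i ^ 2) - ∑ j, c j ^ 2 := by
  have h := two_dvd_sq_sum_sub_sum_sq univ (Sum.elim a (Sum.elim b c))
  simp only [Fintype.sum_sum_type, Sum.elim_inl, Sum.elim_inr] at h
  simpa only [sum_add_distrib, sub_sub, add_assoc] using h

theorem exists_X_sub_C_dvd_sub_C_mul {R : Type*} [CommRing R] (f u : R[X]) (a : R)
    (hu : IsUnit (u.eval a)) : ∃ c : R, X - C a ∣ f - C c * u := by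
  obtain ⟨v, hv⟩ := hu.exists_right_inv
  refine ⟨f.eval a * v, dvd_iff_isRoot.2 ?_⟩
  simp only [IsRoot, eval_sub, eval_mul, eval_C]
  linear_combination -f.eval a * hv

theorem exists_X_sub_C_sq_dvd_sub {R : Type*} [CommRing R] (f u : R[X]) (a : R)
    (hu : IsUnit (u.eval a)) :
    ∃ c d : R, (X - C a) ^ 2 ∣ f - (C c * u + C d * ((X - C a) * u)) := by
  obtain ⟨c, g, hg⟩ := exists_X_sub_C_dvd_sub_C_mul f u a hu
  obtain ⟨d, h, hh⟩ := exists_X_sub_C_dvd_sub_C_mul g u a hu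
  exact ⟨c, d, h, by linear_combination hg + (X - C a) * hh⟩

theorem isUnit_eval_prod_X_sub_C {R ι : Type*} [CommRing R] (t : Finset ι) (x : ι → R) (a : R)
    (h : ∀ i ∈ t, IsUnit (a - x i)) : IsUnit ((∏ i ∈ t, (X - C (x i))).eval a) := by
  rw [eval_prod, IsUnit.prod_iff]
  simpa using h

theorem natDegree_prod_X_sub_C {R ι : Type*} [CommRing R] [Nontrivial R] (t : Finset ι) (x : ι → R) :
    (∏ i ∈ t, (X - C (x i))).natDegree = #t := by
  rw [natDegree_prod_of_monic _ _ fun i _ => monic_X_sub_C _]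
  simp

/-- Partial fractions of `f / (Q₁² Q₂)` with cleared denominators. -/
theorem exists_partial_fractions {A ι κ : Type*} [CommRing A] [Nontrivial A]
    [Fintype ι] [Fintype κ] [DecidableEq ι] [DecidableEq κ]
    (Y : ι → A) (Z : κ → A)
    (hYY : ∀ i i', i ≠ i' → IsUnit (Y i - Y i'))
    (hZZ : ∀ j j', j ≠ j' → IsUnit (Z j - Z j'))
    (hYZ : ∀ i j, IsUnit (Y i - Z j))
    (f : A[X]) (hf : f.natDegree < 2 * Fintype.card ι + Fintype.card κ) :
    ∃ (α β : ι → A) (γ : κ → A), f =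
      ∑ i, (C (α i) * ((∏ i' ∈ univ.erase i, (X - C (Y i'))) ^ 2 * ∏ j, (X - C (Z j)))
        + C (β i) * ((∏ i', (X - C (Y i'))) * (∏ i' ∈ univ.erase i, (X - C (Y i'))) *
            ∏ j, (X - C (Z j))))
      + ∑ j, C (γ j) * ((∏ i, (X - C (Y i))) ^ 2 * ∏ j' ∈ univ.erase j, (X - C (Z j'))) := by
  set Q₁ := ∏ i, (X - C (Y i)) with hQ₁
  set Q₂ := ∏ j, (X - C (Z j)) with hQ₂
  set S : ι → A[X] := fun i => ∏ i' ∈ univ.erase i, (X - C (Y i')) with hS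
  set T : κ → A[X] := fun j => ∏ j' ∈ univ.erase j, (X - C (Z j')) with hT
  have hSQ (i) : (X - C (Y i)) * S i = Q₁ := mul_prod_erase univ (fun i => X - C (Y i)) (mem_univ i)
  have hTQ (j) : (X - C (Z j)) * T j = Q₂ := mul_prod_erase univ (fun j => X - C (Z j)) (mem_univ j)
  have hYQ (i) : X - C (Y i) ∣ Q₁ := ⟨_, (hSQ i).symm⟩
  have hZQ (j) : X - C (Z j) ∣ Q₂ := ⟨_, (hTQ j).symm⟩
  have hYS {i i'} (h : i' ≠ i) : X - C (Y i) ∣ S i' :=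
    dvd_prod_of_mem (fun i => X - C (Y i)) (mem_erase.2 ⟨h.symm, mem_univ _⟩)
  have hZT {j j'} (h : j' ≠ j) : X - C (Z j) ∣ T j' :=
    dvd_prod_of_mem (fun j => X - C (Z j)) (mem_erase.2 ⟨h.symm, mem_univ _⟩)
  have hαβ (i) : ∃ c d : A, (X - C (Y i)) ^ 2 ∣
      f - (C c * (S i ^ 2 * Q₂) + C d * ((X - C (Y i)) * (S i ^ 2 * Q₂))) := by
    apply exists_X_sub_C_sq_dvd_sub
    rw [eval_mul, eval_pow]
    exact ((isUnit_eval_prod_X_sub_C _ _ _ fun i' hi' => hYY _ _ (ne_of_mem_erase hi').symm).pow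
      2).mul (isUnit_eval_prod_X_sub_C _ _ _ fun j _ => hYZ i j)
  have hγ (j) : ∃ c : A, X - C (Z j) ∣ f - C c * (Q₁ ^ 2 * T j) := by
    apply exists_X_sub_C_dvd_sub_C_mul
    rw [eval_mul, eval_pow]
    exact ((isUnit_eval_prod_X_sub_C _ _ _ fun i _ => by
      simpa using (hYZ i j).neg).pow 2).mul
      (isUnit_eval_prod_X_sub_C _ _ _ fun j' hj' => hZZ _ _ (ne_of_mem_erase hj').symm)
  choose α β hαβ using hαβ
  choose γ hγ using hγ
  refine ⟨α, β, γ, ?_⟩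
  set u : ι → A[X] := fun i => C (α i) * (S i ^ 2 * Q₂) + C (β i) * (Q₁ * S i * Q₂) with hu
  set v : κ → A[X] := fun j => C (γ j) * (Q₁ ^ 2 * T j) with hv
  change f = ∑ i, u i + ∑ j, v j
  have dQ₁ : Q₁.natDegree = Fintype.card ι := natDegree_prod_X_sub_C _ _
  have dQ₂ : Q₂.natDegree = Fintype.card κ := natDegree_prod_X_sub_C _ _
  have dS (i) : (S i).natDegree + 1 = Fintype.card ι := by
    rw [hS, natDegree_prod_X_sub_C, card_erase_add_one (mem_univ i), card_univ]
  have dT (j) : (T j).natDegree + 1 = Fintype.card κ := by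
    rw [hT, natDegree_prod_X_sub_C, card_erase_add_one (mem_univ j), card_univ]
  have hYdvd (i) : (X - C (Y i)) ^ 2 ∣ f - (∑ i, u i + ∑ j, v j) := by
    have h₁ : (X - C (Y i)) ^ 2 ∣ f - u i := by
      have := hαβ i
      rwa [show (X - C (Y i)) * (S i ^ 2 * Q₂) = Q₁ * S i * Q₂ by rw [← hSQ i]; ring] at this
    have h₂ : (X - C (Y i)) ^ 2 ∣ ∑ i' ∈ univ.erase i, u i' := by
      refine dvd_sum fun i' hi' => ?_
      have hd := hYS (ne_of_mem_erase hi')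
      refine dvd_add (Dvd.dvd.mul_left (Dvd.dvd.mul_right (pow_dvd_pow_of_dvd hd 2) _) _) ?_
      refine Dvd.dvd.mul_left (Dvd.dvd.mul_right ?_ _) _
      rw [sq]
      exact mul_dvd_mul (hYQ i) hd
    have h₃ : (X - C (Y i)) ^ 2 ∣ ∑ j, v j := dvd_sum fun j _ =>
      Dvd.dvd.mul_left (Dvd.dvd.mul_right (pow_dvd_pow_of_dvd (hYQ i) 2) _) _
    rw [← add_sum_erase univ u (mem_univ i), show f - (u i + ∑ i' ∈ univ.erase i, u i' + ∑ j, v j)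
      = f - u i - ∑ i' ∈ univ.erase i, u i' - ∑ j, v j by ring]
    exact dvd_sub (dvd_sub h₁ h₂) h₃
  have hZdvd (j) : X - C (Z j) ∣ f - (∑ i, u i + ∑ j, v j) := by
    have h₂ : X - C (Z j) ∣ ∑ j' ∈ univ.erase j, v j' := dvd_sum fun j' hj' =>
      Dvd.dvd.mul_left (Dvd.dvd.mul_left (hZT (ne_of_mem_erase hj')) _) _
    have h₃ : X - C (Z j) ∣ ∑ i, u i := dvd_sum fun i _ =>
      dvd_add (Dvd.dvd.mul_left (Dvd.dvd.mul_left (hZQ j) _) _)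
        (Dvd.dvd.mul_left (Dvd.dvd.mul_left (hZQ j) _) _)
    rw [← add_sum_erase univ v (mem_univ j), show f - (∑ i, u i + (v j + ∑ j' ∈ univ.erase j, v j'))
      = f - v j - ∑ j' ∈ univ.erase j, v j' - ∑ i, u i by ring]
    exact dvd_sub (dvd_sub (hγ j) h₂) h₃
  have hdvd : Q₁ ^ 2 * Q₂ ∣ f - (∑ i, u i + ∑ j, v j) := by
    refine IsCoprime.mul_dvd ?_ ?_ ?_
    · exact (IsCoprime.prod_left fun i _ => IsCoprime.prod_right fun j _ =>
        isCoprime_X_sub_C_of_isUnit_sub (hYZ i j)).pow_left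
    · rw [hQ₁, ← prod_pow]
      exact Finset.prod_dvd_of_coprime
        (fun i _ i' _ h => (isCoprime_X_sub_C_of_isUnit_sub (hYY i i' h)).pow) fun i _ => hYdvd i
    · exact Finset.prod_dvd_of_coprime
        (fun j _ j' _ h => isCoprime_X_sub_C_of_isUnit_sub (hZZ j j' h)) fun j _ => hZdvd j
  have mQ₁ : Q₁.Monic := monic_prod_of_monic _ _ fun i _ => monic_X_sub_C _
  have mQ₂ : Q₂.Monic := monic_prod_of_monic _ _ fun i _ => monic_X_sub_C _
  have dQ : (Q₁ ^ 2 * Q₂).natDegree = 2 * Fintype.card ι + Fintype.card κ := by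
    rw [(mQ₁.pow 2).natDegree_mul mQ₂, mQ₁.natDegree_pow, dQ₁, dQ₂]
  have du (i) : (u i).natDegree ≤ 2 * Fintype.card ι + Fintype.card κ - 1 := by
    have := dS i
    refine natDegree_add_le_of_degree_le ?_ ?_ <;> refine (natDegree_C_mul_le _ _).trans ?_
    · have h₁ := natDegree_mul_le (p := S i ^ 2) (q := Q₂)
      have h₂ := natDegree_pow_le (p := S i) (n := 2)
      omega
    · have h₁ := natDegree_mul_le (p := Q₁ * S i) (q := Q₂)
      have h₂ := natDegree_mul_le (p := Q₁) (q := S i)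
      omega
  have dv (j) : (v j).natDegree ≤ 2 * Fintype.card ι + Fintype.card κ - 1 := by
    have := dT j
    refine (natDegree_C_mul_le _ _).trans ?_
    have h₁ := natDegree_mul_le (p := Q₁ ^ 2) (q := T j)
    have h₂ := natDegree_pow_le (p := Q₁) (n := 2)
    omega
  have dg : (f - (∑ i, u i + ∑ j, v j)).natDegree ≤
      2 * Fintype.card ι + Fintype.card κ - 1 :=
    (natDegree_sub_le_of_le (Nat.le_sub_one_of_lt hf) (natDegree_add_le_of_degree_le
      (natDegree_sum_le_of_forall_le _ _ fun i _ => du i)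
      (natDegree_sum_le_of_forall_le _ _ fun j _ => dv j))).trans_eq (max_self _)
  by_contra hne
  have := ((mQ₁.pow 2).mul mQ₂).not_dvd_of_natDegree_lt (sub_ne_zero.2 hne) (by omega)
  exact this hdvd

/-- Lemma 3 of the paper: partial-fraction decomposition of `X^ℓ/(Q₁²Q₂)` squared.
Writing `Q₁ = ∏_{i≤r}(X−X_i)`, `Q₂ = ∏_{r<j≤r+s}(X−X_j)`, `S_i = Q₁/(X−X_i)` and
`T_j = Q₂/(X−X_j)`, for each `0 ≤ ℓ ≤ n−1` (`n = 2r+s`) there exist coefficients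
`α_{iℓ}, β_{iℓ}, γ_{jℓ}` with all `α_{iℓ}`, `γ_{jℓ}` nonzero such that
`X^{2ℓ} − ∑_i (α_{iℓ}² S_i⁴ Q₂² + β_{iℓ}² Q₁² S_i² Q₂²) − ∑_j γ_{jℓ}² Q₁⁴ T_j²`
lies in `2·A[X]` and has degree at most `2n−1`. -/
theorem lemma3 (A : Type*) [CommRing A] [IsDomain A] (r s : ℕ) (hr : 1 ≤ r)
    (n : ℕ) (hn : n = 2 * r + s)
    (Y : Fin r → A) (Z : Fin s → A)
    (hY0 : ∀ i, Y i ≠ 0) (hZ0 : ∀ j, Z j ≠ 0)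
    (hYY : ∀ i i', i ≠ i' → IsUnit (Y i - Y i'))
    (hZZ : ∀ j j', j ≠ j' → IsUnit (Z j - Z j'))
    (hYZ : ∀ i j, IsUnit (Y i - Z j))
    (ℓ : ℕ) (hℓ : ℓ ≤ n - 1) :
    ∃ (α β : Fin r → A) (γ : Fin s → A),
      (∀ i, α i ≠ 0) ∧ (∀ j, γ j ≠ 0) ∧
      ∀ p : A[X],
        p = (X : A[X]) ^ (2 * ℓ)
            - (∑ i, (C (α i ^ 2) * (∏ i' ∈ univ.erase i, (X - C (Y i'))) ^ 4 *
                      (∏ j, (X - C (Z j))) ^ 2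
                    + C (β i ^ 2) * (∏ i', (X - C (Y i'))) ^ 2 *
                      (∏ i' ∈ univ.erase i, (X - C (Y i'))) ^ 2 *
                      (∏ j, (X - C (Z j))) ^ 2))
            - (∑ j, C (γ j ^ 2) * (∏ i, (X - C (Y i))) ^ 4 *
                (∏ j' ∈ univ.erase j, (X - C (Z j'))) ^ 2) →
        p ∈ Ideal.span {(2 : A[X])} ∧ p.natDegree ≤ 2 * n - 1 := by
  obtain ⟨α, β, γ, h⟩ := exists_partial_fractions Y Z hYY hZZ hYZ ((X : A[X]) ^ ℓ)
    (by simp; omega)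
  set Q₁ := ∏ i, (X - C (Y i)) with hQ₁
  set Q₂ := ∏ j, (X - C (Z j)) with hQ₂
  set S : Fin r → A[X] := fun i => ∏ i' ∈ univ.erase i, (X - C (Y i')) with hS
  set T : Fin s → A[X] := fun j => ∏ j' ∈ univ.erase j, (X - C (Z j')) with hT
  have eQ₁ (i) : Q₁.eval (Y i) = 0 := by
    rw [hQ₁, eval_prod]; exact prod_eq_zero (mem_univ i) (by simp)
  have eQ₂ (j) : Q₂.eval (Z j) = 0 := by
    rw [hQ₂, eval_prod]; exact prod_eq_zero (mem_univ j) (by simp)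
  have eS {i i'} (hi : i' ≠ i) : (S i').eval (Y i) = 0 := by
    simp only [hS, eval_prod]
    exact prod_eq_zero (mem_erase.2 ⟨hi.symm, mem_univ _⟩) (by simp)
  have eT {j j'} (hj : j' ≠ j) : (T j').eval (Z j) = 0 := by
    simp only [hT, eval_prod]
    exact prod_eq_zero (mem_erase.2 ⟨hj.symm, mem_univ _⟩) (by simp)
  refine ⟨α, β, γ, fun i hi => ?_, fun j hj => ?_, ?_⟩
  · have h' := congrArg (eval (Y i)) h
    simp only [eval_pow, eval_X, eval_add, eval_finsetSum, eval_mul, eval_C, eQ₁] at h'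
    rw [sum_eq_single_of_mem i (mem_univ i) fun i' _ hi' => by
      change α i' * ((S i').eval (Y i) ^ 2 * _) + _ = 0; simp [eS hi']] at h'
    simp [hi, hY0] at h'
  · have h' := congrArg (eval (Z j)) h
    simp only [eval_pow, eval_X, eval_add, eval_finsetSum, eval_mul, eval_C, eQ₂] at h'
    rw [sum_eq_single_of_mem (s := univ (α := Fin s)) j (mem_univ j) fun j' _ hj' => by
      change γ j' * (_ * (T j').eval (Z j)) = 0; simp [eT hj']] at h'
    simp [hj, hZ0] at h'
  rintro p rfl
  constructor
  · rw [Ideal.mem_span_singleton]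
    have h₂ := two_dvd_sq_sub_sum_sq (fun i => C (α i) * (S i ^ 2 * Q₂))
      (fun i => C (β i) * (Q₁ * S i * Q₂)) (fun j => C (γ j) * (Q₁ ^ 2 * T j))
    rw [← h, ← pow_mul, mul_comm ℓ 2] at h₂
    refine h₂.trans (dvd_of_eq ?_)
    refine congrArg₂ (· - ·) (congrArg₂ (· - ·) rfl (sum_congr rfl fun i _ => ?_))
      (sum_congr rfl fun j _ => ?_)
    · rw [C_pow, C_pow]
      ring
    · rw [C_pow]
      ring
  · have dQ₁ : Q₁.natDegree = r := by rw [hQ₁, natDegree_prod_X_sub_C, card_univ, Fintype.card_fin]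
    have dQ₂ : Q₂.natDegree = s := by rw [hQ₂, natDegree_prod_X_sub_C, card_univ, Fintype.card_fin]
    have dS (i) : (S i).natDegree + 1 = r := by
      rw [hS, natDegree_prod_X_sub_C, card_erase_add_one (mem_univ i), card_univ, Fintype.card_fin]
    have dT (j) : (T j).natDegree + 1 = s := by
      rw [hT, natDegree_prod_X_sub_C, card_erase_add_one (mem_univ j), card_univ, Fintype.card_fin]
    have dmul {p q : A[X]} {k l : ℕ} (hp : p.natDegree ≤ k) (hq : q.natDegree ≤ l) :
        (p * q).natDegree ≤ k + l := natDegree_mul_le_of_le hp hq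
    have hpow {p : A[X]} {m k : ℕ} (hp : p.natDegree ≤ k) : (p ^ m).natDegree ≤ m * k :=
      natDegree_pow_le_of_le m hp
    refine natDegree_sub_le_of_le (natDegree_sub_le_of_le ?_ ?_) ?_ |>.trans_eq
      ((congrArg (max · _) (max_self _)).trans (max_self (2 * n - 1)))
    · rw [natDegree_X_pow]
      omega
    · refine natDegree_sum_le_of_forall_le _ _ fun i _ => ?_
      have := dS i
      refine natDegree_add_le_of_degree_le ?_ ?_
      · exact (dmul (dmul (natDegree_C _).le (hpow le_rfl)) (hpow dQ₂.le)).trans (by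
          change 0 + 4 * (S i).natDegree + 2 * s ≤ _; omega)
      · exact (dmul (dmul (dmul (natDegree_C _).le (hpow dQ₁.le)) (hpow le_rfl))
          (hpow dQ₂.le)).trans (by
          change 0 + 2 * r + 2 * (S i).natDegree + 2 * s ≤ _; omega)
    · refine natDegree_sum_le_of_forall_le _ _ fun j _ => ?_
      have := dT j
      exact (dmul (dmul (natDegree_C _).le (hpow dQ₁.le)) (hpow le_rfl)).trans (by
        change 0 + 4 * r + 2 * (T j).natDegree ≤ _; omega)
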